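/- Assume f = (1/n)∑_{i=1}^n f_i is (m,b)-dissipative, each ∇f_i is L-Lipschitz, and G = max_{i∈[n]} ‖∇f_i(0)‖₂. Let β > 0 and let η satisfy 0 < η ≤ min{1, m/(4L²)}. For any x ∈ ℝ^d, let I be a uniformly random size-B subset of {1,…,n} and ε ∼ N(0, I_d) independent of I. Then E[ ‖x − η g(x,I) + √(2η/β) ε‖₂² ] ≤ (1 − 3mη/2)‖x‖₂² + 2ηb + 2ηG² + 2dη/β. -/

import Mathlib

open MeasureTheory
open scoped InnerProductSpace BigOperators

/-- The mini-batch stochastic gradient `g(x, I) = (1/B) ∑_{i ∈ I} ∇f_i(x)`. -/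
noncomputable def stochGrad {d n : ℕ} (fi : Fin n → EuclideanSpace ℝ (Fin d) → ℝ) (B : ℕ)
    (x : EuclideanSpace ℝ (Fin d)) (I : Finset (Fin n)) : EuclideanSpace ℝ (Fin d) :=
  (B : ℝ)⁻¹ • ∑ i ∈ I, gradient (fi i) x

/-- Expectation of `X` over a uniformly random size-`B` subset `I` of `{1,…,n}`. -/
noncomputable def expectSubsets (n B : ℕ) (X : Finset (Fin n) → ℝ) : ℝ :=
  (∑ I ∈ Finset.univ.filter (fun I : Finset (Fin n) => I.card = B), X I) /
    ((Finset.univ.filter (fun I : Finset (Fin n) => I.card = B)).card : ℝ)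

/-- The Gaussian measure `N(μ, σ2 · I_d)` on `ℝ^d`, defined via its density with
respect to the Lebesgue measure. -/
noncomputable def gaussMeasure {d : ℕ} (μ : EuclideanSpace ℝ (Fin d)) (σ2 : ℝ) :
    Measure (EuclideanSpace ℝ (Fin d)) :=
  volume.withDensity fun x =>
    ENNReal.ofReal ((2 * Real.pi * σ2) ^ (-(d : ℝ) / 2) * Real.exp (-‖x - μ‖ ^ 2 / (2 * σ2)))

open ProbabilityTheory

/-- The density definition of the standard Gaussian agrees with Mathlib's `stdGaussian`. -/
theorem gaussMeasure_zero_one (d : ℕ) :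
    gaussMeasure (0 : EuclideanSpace ℝ (Fin d)) 1 = stdGaussian (EuclideanSpace ℝ (Fin d)) := by
  set c : ℝ := (2 * Real.pi) ^ (-(d : ℝ) / 2) with hc
  have hc0 : 0 < c := by positivity
  have hμ : gaussMeasure (0 : EuclideanSpace ℝ (Fin d)) 1 = volume.withDensity fun x =>
      ENNReal.ofReal (c * Real.exp (-(1 / 2) * ‖x‖ ^ 2)) := by
    simp only [gaussMeasure, sub_zero, mul_one, ← hc]
    congr! 5
    ring
  have hexp : Integrable fun x : EuclideanSpace ℝ (Fin d) => Real.exp (-(1 / 2) * ‖x‖ ^ 2) := by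
    refine (GaussianFourier.integrable_cexp_neg_mul_sq_norm_add
      (V := EuclideanSpace ℝ (Fin d)) (b := 1 / 2) (by norm_num) 0 0).re.congr
      (Filter.Eventually.of_forall fun x => ?_)
    have : (-(1 / 2) * (‖x‖ : ℂ) ^ 2) = ((-(1 / 2) * ‖x‖ ^ 2 : ℝ) : ℂ) := by push_cast; ring
    simp only [zero_mul, add_zero, this]
    exact Complex.exp_ofReal_re _
  have : IsFiniteMeasure (gaussMeasure (0 : EuclideanSpace ℝ (Fin d)) 1) :=
    hμ ▸ isFiniteMeasure_withDensity_ofReal (hexp.const_mul c).2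
  refine Measure.ext_of_charFun ?_
  ext t
  rw [charFun_stdGaussian, charFun_apply, hμ,
    integral_withDensity_eq_integral_toReal_smul (by fun_prop) (by simp)]
  have hint : ∀ x : EuclideanSpace ℝ (Fin d),
      (ENNReal.ofReal (c * Real.exp (-(1 / 2) * ‖x‖ ^ 2))).toReal •
        Complex.exp (⟪x, t⟫_ℝ * Complex.I) =
      c * Complex.exp (-(1 / 2) * ‖x‖ ^ 2 + Complex.I * ⟪t, x⟫_ℝ) := by
    intro x
    rw [ENNReal.toReal_ofReal (by positivity), Complex.exp_add, Complex.real_smul,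
      real_inner_comm]
    push_cast
    ring_nf
  simp_rw [hint]
  rw [integral_const_mul, GaussianFourier.integral_cexp_neg_mul_sq_norm_add (by norm_num)]
  have hconst : (c : ℂ) * ((Real.pi : ℂ) / (1 / 2)) ^
      ((Module.finrank ℝ (EuclideanSpace ℝ (Fin d)) : ℂ) / 2) = 1 := by
    have h2 : ((Real.pi : ℂ) / (1 / 2)) = ((2 * Real.pi : ℝ) : ℂ) := by push_cast; ring
    have h3 : ((Module.finrank ℝ (EuclideanSpace ℝ (Fin d)) : ℂ) / 2) = ((d / 2 : ℝ) : ℂ) := by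
      simp
    rw [h2, h3, ← Complex.ofReal_cpow (by positivity), ← Complex.ofReal_mul, hc,
      ← Real.rpow_add (by positivity), neg_div, neg_add_cancel, Real.rpow_zero, Complex.ofReal_one]
  rw [← mul_assoc, hconst, one_mul, Complex.I_sq]
  congr 1
  ring

theorem integral_norm_sq_stdGaussian (d : ℕ) :
    ∫ e, ‖e‖ ^ 2 ∂(stdGaussian (EuclideanSpace ℝ (Fin d))) = d := by
  let v := EuclideanSpace.basisFun (Fin d) ℝ
  have hsq : ∀ i, ∫ e, ⟪v i, e⟫_ℝ ^ 2 ∂(stdGaussian (EuclideanSpace ℝ (Fin d))) = 1 := by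
    intro i
    have h := variance_dual_stdGaussian (innerSL ℝ (v i))
    rw [variance_of_integral_eq_zero (by fun_prop) (integral_strongDual_stdGaussian _)] at h
    simpa [innerSL_apply_norm] using h
  have hint : ∀ i, Integrable (fun e => ⟪v i, e⟫_ℝ ^ 2)
      (stdGaussian (EuclideanSpace ℝ (Fin d))) := fun i =>
    ((innerSL ℝ (v i)).comp_memLp' IsGaussian.memLp_two_id).integrable_sq
  simp_rw [← v.sum_sq_inner_right]
  rw [integral_finsetSum _ fun i _ => hint i]
  simp [hsq]

theorem integral_norm_add_smul_sq_gaussMeasure {d : ℕ} (a : EuclideanSpace ℝ (Fin d)) (c : ℝ) :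
    ∫ e, ‖a + c • e‖ ^ 2 ∂(gaussMeasure (0 : EuclideanSpace ℝ (Fin d)) 1) =
      ‖a‖ ^ 2 + c ^ 2 * d := by
  rw [gaussMeasure_zero_one]
  have hexpand : ∀ e : EuclideanSpace ℝ (Fin d),
      ‖a + c • e‖ ^ 2 = ‖a‖ ^ 2 + 2 * c * innerSL ℝ a e + c ^ 2 * ‖e‖ ^ 2 := by
    intro e
    rw [norm_add_sq_real, inner_smul_right, norm_smul, mul_pow, Real.norm_eq_abs, sq_abs,
      innerSL_apply_apply]
    ring
  have h1 : Integrable (innerSL ℝ a) (stdGaussian (EuclideanSpace ℝ (Fin d))) :=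
    (innerSL ℝ a).integrable_comp IsGaussian.integrable_id
  have h2 : Integrable (fun e => ‖e‖ ^ 2) (stdGaussian (EuclideanSpace ℝ (Fin d))) :=
    IsGaussian.memLp_two_id.integrable_norm_pow two_ne_zero
  have h3 : Integrable (fun e => ‖a‖ ^ 2 + 2 * c * innerSL ℝ a e)
      (stdGaussian (EuclideanSpace ℝ (Fin d))) := (integrable_const _).add (h1.const_mul _)
  simp_rw [hexpand]
  rw [integral_add h3 (h2.const_mul _),
    integral_add (integrable_const _) (h1.const_mul _), integral_const_mul, integral_const_mul,
    integral_strongDual_stdGaussian, integral_norm_sq_stdGaussian]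
  simp

theorem expectSubsets_mono {n B : ℕ} {X Y : Finset (Fin n) → ℝ}
    (h : ∀ I : Finset (Fin n), I.card = B → X I ≤ Y I) :
    expectSubsets n B X ≤ expectSubsets n B Y := by
  unfold expectSubsets
  gcongr with I hI
  exact h I (Finset.mem_filter.mp hI).2

theorem card_powersetCard_filter_mem {n B : ℕ} (hB : 1 ≤ B) (i : Fin n) :
    ((Finset.univ.powersetCard B).filter fun I : Finset (Fin n) => i ∈ I).card =
      (n - 1).choose (B - 1) := by
  simpa using Finset.card_filter_powersetCard_subset {i} Finset.univ B (by simp) (by simpa)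

/-- A uniformly random subset of size `B` selects each index with probability `B / n`. -/
theorem expectSubsets_affine {n B : ℕ} (hB : 1 ≤ B) (hBn : B ≤ n) (A : ℝ) (a : Fin n → ℝ) :
    expectSubsets n B (fun I => A + (B : ℝ)⁻¹ * ∑ i ∈ I, a i) = A + (n : ℝ)⁻¹ * ∑ i, a i := by
  have hswap : ∑ I ∈ Finset.univ.powersetCard B, ∑ i ∈ I, a i =
      (n - 1).choose (B - 1) * ∑ i, a i := by
    rw [Finset.sum_comm' (s' := fun i => (Finset.univ.powersetCard B).filter fun I => i ∈ I)
      (t' := Finset.univ) (by simp)]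
    simp [card_powersetCard_filter_mem hB, Finset.mul_sum]
  have hchoose : (n : ℝ) * (n - 1).choose (B - 1) = n.choose B * B := by
    obtain ⟨k, rfl⟩ := Nat.exists_eq_add_of_le' hB
    obtain ⟨l, rfl⟩ := Nat.exists_eq_add_of_le' (hB.trans hBn)
    exact_mod_cast Nat.add_one_mul_choose_eq l k
  have hpos : (0 : ℝ) < n.choose B := by exact_mod_cast Nat.choose_pos hBn
  have hB0 : (0 : ℝ) < B := by exact_mod_cast hB
  have hn0 : (0 : ℝ) < n := by exact_mod_cast hB.trans hBn
  rw [expectSubsets, Finset.univ_filter_card_eq, Finset.sum_add_distrib, ← Finset.mul_sum,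
    hswap, Finset.sum_const,
    Finset.card_powersetCard, Finset.card_univ, Fintype.card_fin, nsmul_eq_mul]
  field_simp
  linear_combination (∑ i, a i) * hchoose

theorem gradient_average {d n : ℕ} {fi : Fin n → EuclideanSpace ℝ (Fin d) → ℝ}
    (hfi : ∀ i, Differentiable ℝ (fi i)) (x : EuclideanSpace ℝ (Fin d)) :
    gradient (fun y => (n : ℝ)⁻¹ * ∑ i, fi i y) x = (n : ℝ)⁻¹ • ∑ i, gradient (fi i) x := by
  refine HasGradientAt.gradient ?_
  rw [hasGradientAt_iff_hasFDerivAt]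
  convert! (HasFDerivAt.fun_sum fun i (_ : i ∈ Finset.univ) =>
    (hfi i x).hasFDerivAt).const_mul (n : ℝ)⁻¹ using 1
  simp [gradient]

theorem norm_stochGrad_le {d n B : ℕ} {fi : Fin n → EuclideanSpace ℝ (Fin d) → ℝ}
    {x : EuclideanSpace ℝ (Fin d)} {C : ℝ} (hC : ∀ i, ‖gradient (fi i) x‖ ≤ C) (hB : 1 ≤ B)
    {I : Finset (Fin n)} (hI : I.card = B) : ‖stochGrad fi B x I‖ ≤ C := by
  have hB0 : (0 : ℝ) < B := by exact_mod_cast hB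
  rw [stochGrad, norm_smul, norm_inv, Real.norm_of_nonneg hB0.le, inv_mul_le_iff₀ hB0]
  simpa [hI] using norm_sum_le_of_le I fun i _ => hC i


theorem statement16 {d n : ℕ} (hn : 0 < n)
    (fi : Fin n → EuclideanSpace ℝ (Fin d) → ℝ)
    (f : EuclideanSpace ℝ (Fin d) → ℝ) (hf : f = fun x => (n : ℝ)⁻¹ * ∑ i, fi i x)
    (m b L G : ℝ) (hm : 0 < m) (hb : 0 ≤ b)
    (hC1 : ∀ i, ContDiff ℝ 1 (fi i))
    (hdiss : ∀ x : EuclideanSpace ℝ (Fin d), m * ‖x‖ ^ 2 - b ≤ ⟪gradient f x, x⟫_ℝ)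
    (hLip : ∀ i, ∀ x y : EuclideanSpace ℝ (Fin d),
      ‖gradient (fi i) x - gradient (fi i) y‖ ≤ L * ‖x - y‖)
    (hG : G = Finset.sup' Finset.univ (Finset.univ_nonempty_iff.mpr ⟨⟨0, hn⟩⟩)
      (fun i => ‖gradient (fi i) (0 : EuclideanSpace ℝ (Fin d))‖))
    (βv η : ℝ) (hβ : 0 < βv) (hη0 : 0 < η) (hη : η ≤ min 1 (m / (4 * L ^ 2)))
    (B : ℕ) (hB1 : 1 ≤ B) (hBn : B ≤ n)
    (x : EuclideanSpace ℝ (Fin d)) :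
    expectSubsets n B (fun I =>
        ∫ e, ‖x - η • stochGrad fi B x I + Real.sqrt (2 * η / βv) • e‖ ^ 2
          ∂(gaussMeasure (0 : EuclideanSpace ℝ (Fin d)) 1)) ≤
      (1 - 3 * m * η / 2) * ‖x‖ ^ 2 + 2 * η * b + 2 * η * G ^ 2 + 2 * d * η / βv := by
  have hη1 : η ≤ 1 := hη.trans (min_le_left _ _)
  have hηL : 4 * L ^ 2 * η ≤ m := by
    rcases (sq_nonneg L).eq_or_lt with h0 | h0
    · rw [← h0]; linarith
    · have := (le_div_iff₀ (by positivity)).mp (hη.trans (min_le_right _ _))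
      linarith
  have hgrad : ∀ i, ‖gradient (fi i) x‖ ≤ L * ‖x‖ + G := by
    intro i
    have h0 : ‖gradient (fi i) 0‖ ≤ G :=
      hG ▸ Finset.le_sup' (fun i => ‖gradient (fi i) (0 : EuclideanSpace ℝ (Fin d))‖)
        (Finset.mem_univ i)
    have h1 := hLip i x 0
    rw [sub_zero] at h1
    linarith [norm_le_norm_add_norm_sub' (gradient (fi i) x) (gradient (fi i) 0)]
  have hstep : ∀ I : Finset (Fin n), I.card = B →
      ∫ e, ‖x - η • stochGrad fi B x I + Real.sqrt (2 * η / βv) • e‖ ^ 2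
          ∂(gaussMeasure (0 : EuclideanSpace ℝ (Fin d)) 1) ≤
        (‖x‖ ^ 2 + η ^ 2 * (2 * L ^ 2 * ‖x‖ ^ 2 + 2 * G ^ 2) + 2 * η / βv * d) +
          (B : ℝ)⁻¹ * ∑ i ∈ I, -(2 * η) * ⟪gradient (fi i) x, x⟫_ℝ := by
    intro I hI
    have hg : ‖stochGrad fi B x I‖ ^ 2 ≤ 2 * L ^ 2 * ‖x‖ ^ 2 + 2 * G ^ 2 := by
      have := pow_le_pow_left₀ (norm_nonneg _) (norm_stochGrad_le hgrad hB1 hI) 2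
      nlinarith [sq_nonneg (L * ‖x‖ - G)]
    have hinner : ⟪x, stochGrad fi B x I⟫_ℝ = (B : ℝ)⁻¹ * ∑ i ∈ I, ⟪gradient (fi i) x, x⟫_ℝ := by
      rw [real_inner_comm, stochGrad, real_inner_smul_left, sum_inner]
    rw [integral_norm_add_smul_sq_gaussMeasure, Real.sq_sqrt (by positivity), norm_sub_sq_real,
      real_inner_smul_right, hinner, norm_smul, mul_pow, Real.norm_eq_abs, sq_abs,
      ← Finset.mul_sum]
    linarith [mul_le_mul_of_nonneg_left hg (sq_nonneg η)]
  refine (expectSubsets_mono hstep).trans ?_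
  have hdx := hdiss x
  rw [hf, gradient_average (fun i => (hC1 i).differentiable one_ne_zero), real_inner_smul_left,
    sum_inner] at hdx
  rw [expectSubsets_affine hB1 hBn, ← Finset.mul_sum]
  have e1 := mul_le_mul_of_nonneg_left hdx (by positivity : 0 ≤ 2 * η)
  have e2 := mul_le_mul_of_nonneg_right hηL (by positivity : 0 ≤ η * ‖x‖ ^ 2)
  have e3 := mul_le_mul_of_nonneg_right hη1 (by positivity : 0 ≤ η * G ^ 2)
  have e4 : 2 * η / βv * d = 2 * d * η / βv := by ring
  rw [e4]
  linarith
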